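/- With notation as in the gluing construction (C = k_1A ∪ k_2B, k_1 ∈ ⟨B⟩, k_2 ∈ ⟨A⟩, gcd(k_1,k_2)=1), the element k_1·F_A + k_2·F_B + k_1·k_2 does not belong to the semigroup ⟨C⟩ generated by C. -/

import Mathlib

/-- The numerical semigroup (additive submonoid of ℕ) generated by a set `A`. -/
def NS (A : Set ℕ) : AddSubmonoid ℕ := AddSubmonoid.closure A

/-- `F` is the Frobenius number of `S`: `F ∉ S` and every larger integer lies in `S`. -/
def IsFrobenius (S : AddSubmonoid ℕ) (F : ℕ) : Prop :=
  F ∉ S ∧ ∀ m : ℕ, F < m → m ∈ S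

/-- The generating set `k₁A ∪ k₂B` of the gluing. -/
def glueGens (A B : Set ℕ) (k1 k2 : ℕ) : Set ℕ :=
  (fun a => k1 * a) '' A ∪ (fun b => k2 * b) '' B

theorem glue_decomp (A B : Set ℕ) (k1 k2 n : ℕ) (h : n ∈ NS (glueGens A B k1 k2)) :
    ∃ a ∈ NS A, ∃ b ∈ NS B, n = k1 * a + k2 * b := by
  unfold NS at h
  induction h using AddSubmonoid.closure_induction with
  | mem x hx =>
    rcases hx with ⟨a, ha, rfl⟩ | ⟨b, hb, rfl⟩
    · exact ⟨a, AddSubmonoid.subset_closure ha, 0, zero_mem _, by simp⟩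
    · exact ⟨0, zero_mem _, b, AddSubmonoid.subset_closure hb, by simp⟩
  | zero => exact ⟨0, zero_mem _, 0, zero_mem _, by simp⟩
  | add x y _ _ hx hy =>
    obtain ⟨a, ha, b, hb, rfl⟩ := hx
    obtain ⟨a', ha', b', hb', rfl⟩ := hy
    exact ⟨a + a', add_mem ha ha', b + b', add_mem hb hb', by ring⟩

theorem mul_mem_NS (S : AddSubmonoid ℕ) (k n : ℕ) (h : k ∈ S) : k * n ∈ S := by
  have := S.nsmul_mem h n
  rwa [smul_eq_mul, mul_comm] at this

/-- `k₁F_A + k₂F_B + k₁k₂` is not in the gluing semigroup `⟨C⟩`. -/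
theorem glue_frobenius_not_mem (A B : Set ℕ) (FA FB k1 k2 : ℕ)
    (hFA : IsFrobenius (NS A) FA) (hFB : IsFrobenius (NS B) FB)
    (hk1B : k1 ∈ NS B) (hk2A : k2 ∈ NS A)
    (hcop : Nat.Coprime k1 k2) :
    k1 * FA + k2 * FB + k1 * k2 ∉ NS (glueGens A B k1 k2) := by
  intro h
  obtain ⟨a, ha, b, hb, hab⟩ := glue_decomp A B k1 k2 _ h
  rcases Nat.eq_zero_or_pos k2 with h0 | hpos
  · subst h0
    have h1 : k1 = 1 := by simpa using hcop
    subst h1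
    have : FA = a := by simpa using hab
    exact hFA.1 (this ▸ ha)
  have hz : (k1 : ℤ) * FA + k2 * FB + k1 * k2 = k1 * a + k2 * b := by exact_mod_cast hab
  have hd : (k2 : ℤ) ∣ (a : ℤ) - FA := by
    have hc : IsCoprime (k2 : ℤ) (k1 : ℤ) := (Nat.isCoprime_iff_coprime.mpr hcop).symm
    apply hc.dvd_of_dvd_mul_left
    exact ⟨FB + k1 - b, by linear_combination -hz⟩
  obtain ⟨t, ht⟩ := hd
  have hb' : (b : ℤ) = FB + k1 * (1 - t) := by
    have hk : (k2 : ℤ) ≠ 0 := by exact_mod_cast hpos.ne'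
    apply mul_left_cancel₀ hk
    linear_combination -hz - k1 * ht
  rcases le_or_gt t 0 with h0 | h1
  · obtain ⟨s, hs⟩ := Int.eq_ofNat_of_zero_le (show 0 ≤ -t by omega)
    have : FA = a + k2 * s := by
      zify
      rw [← hs]
      linear_combination -ht
    exact hFA.1 (this ▸ add_mem ha (mul_mem_NS _ _ _ hk2A))
  · obtain ⟨s, hs⟩ := Int.eq_ofNat_of_zero_le (show 0 ≤ t - 1 by omega)
    have : FB = b + k1 * s := by
      zify
      rw [← hs]
      linear_combination -hb'
    exact hFB.1 (this ▸ add_mem hb (mul_mem_NS _ _ _ hk1B))
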